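/- Let d be a positive integer and let c : ℝ^d → ℂ be an ℝ^d-configuration (finite range) whose support is a Delone set of finite local complexity. If c is annihilated by a line ℝ^d-polynomial f in direction v (i.e., supp(f) has at least two points and supp(f) ⊆ u_0 + ℝ·v for some u_0 ∈ ℝ^d and nonzero v ∈ ℝ^d), then c is periodic in direction v, i.e., c is k·v-periodic for some nonzero real k. -/

import Mathlib

/- STATEMENT 11: A Delone configuration of finite local complexity annihilated by
   a line ℝ^d-polynomial in direction v is periodic in direction v. -/

open scoped Pointwise

noncomputable section

abbrev Euc (d : ℕ) := EuclideanSpace ℝ (Fin d)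

def conv {d : ℕ} (f c : Euc d → ℂ) (u : Euc d) : ℂ := ∑ᶠ w, f w * c (u - w)

def Annihilates {d : ℕ} (f c : Euc d → ℂ) : Prop := ∀ u, conv f c u = 0

def UniformlyDiscrete {d : ℕ} (S : Set (Euc d)) : Prop :=
  ∃ r > (0:ℝ), ∀ x : Euc d, (S ∩ Metric.ball x r).Subsingleton

def RelativelyDense {d : ℕ} (S : Set (Euc d)) : Prop :=
  ∃ R > (0:ℝ), ∀ x : Euc d, (S ∩ Metric.closedBall x R).Nonempty

def IsDelone {d : ℕ} (S : Set (Euc d)) : Prop := UniformlyDiscrete S ∧ RelativelyDense S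

def SetLocallyFinite {d : ℕ} (S : Set (Euc d)) : Prop :=
  ∀ B : Set (Euc d), Bornology.IsBounded B → (S ∩ B).Finite

def DeloneFLC {d : ℕ} (S : Set (Euc d)) : Prop := IsDelone S ∧ SetLocallyFinite (S - S)

/-- `f` is a line ℝ^d-polynomial in direction `v`. -/
def IsLinePolynomial {d : ℕ} (f : Euc d → ℂ) (v : Euc d) : Prop :=
  (Function.support f).Finite ∧ v ≠ 0 ∧
  (∃ x ∈ Function.support f, ∃ y ∈ Function.support f, x ≠ y) ∧
  ∃ u₀ : Euc d, ∀ x ∈ Function.support f, ∃ r : ℝ, x = u₀ + r • v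

theorem aux_forward (A : Finset ℝ) (hA : A.Nonempty) (a : ℝ → ℂ) (ha : ∀ t ∈ A, a t ≠ 0)
    (T : ℝ) (hT0 : 0 < T) (hT : ∀ s ∈ A, ∀ t ∈ A, s - t ≤ T) (g : ℝ → ℂ)
    (hg : ∀ s, ∑ t ∈ A, a t * g (s - t) = 0)
    (h0 : ∀ t, -T ≤ t → t ≤ T → g t = 0) : ∀ t, 0 ≤ t → g t = 0 := by
  obtain ⟨m, hm, hmin⟩ := A.exists_min_image id hA
  simp only [id] at hmin
  obtain ⟨δ, hδ, hδA⟩ : ∃ δ : ℝ, 0 < δ ∧ ∀ t ∈ A, t ≠ m → m + δ ≤ t := by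
    by_cases hne : (A.erase m).Nonempty
    · obtain ⟨m', hm', hmin'⟩ := (A.erase m).exists_min_image id hne
      simp only [id] at hmin'
      have h1 := Finset.mem_erase.1 hm'
      refine ⟨m' - m, sub_pos.2 (lt_of_le_of_ne (hmin _ h1.2) (Ne.symm h1.1)), ?_⟩
      intro t ht htm
      have := hmin' t (Finset.mem_erase.2 ⟨htm, ht⟩)
      linarith
    · refine ⟨1, one_pos, ?_⟩
      intro t ht htm
      exact absurd ⟨t, Finset.mem_erase.2 ⟨htm, ht⟩⟩ hne
  have key : ∀ n : ℕ, ∀ t, -T ≤ t → t ≤ n * δ → g t = 0 := by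
    intro n
    induction n with
    | zero =>
      intro t h1 h2
      apply h0 t h1
      simp at h2
      linarith
    | succ n ih =>
      intro y h1 h2
      push_cast at h2
      by_cases hy : y ≤ T
      · exact h0 y h1 hy
      push Not at hy
      have h3 := hg (y + m)
      rw [Finset.sum_eq_single_of_mem m hm] at h3
      · have h4 := (mul_eq_zero.1 h3).resolve_left (ha m hm)
        simpa using h4
      · intro t ht htm
        have h5 := hδA t ht htm
        have h6 := hT t ht m hm
        rw [ih (y + m - t) (by linarith) (by linarith), mul_zero]
  intro t ht
  obtain ⟨n, hn⟩ := exists_nat_ge (t / δ)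
  exact key n t (by linarith) ((div_le_iff₀ hδ).1 hn)

theorem aux_all (A : Finset ℝ) (hA : A.Nonempty) (a : ℝ → ℂ) (ha : ∀ t ∈ A, a t ≠ 0)
    (T : ℝ) (hT0 : 0 < T) (hT : ∀ s ∈ A, ∀ t ∈ A, s - t ≤ T) (g : ℝ → ℂ)
    (hg : ∀ s, ∑ t ∈ A, a t * g (s - t) = 0)
    (h0 : ∀ t, -T ≤ t → t ≤ T → g t = 0) : ∀ t, g t = 0 := by
  intro t
  rcases le_total 0 t with h | h
  · exact aux_forward A hA a ha T hT0 hT g hg h0 t h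
  · have := aux_forward (A.image (fun x => -x)) (hA.image _) (fun t => a (-t))
      (by
        intro t ht
        obtain ⟨s, hs, rfl⟩ := Finset.mem_image.1 ht
        simpa using ha s hs) T hT0
      (by
        intro s' hs' t' ht'
        obtain ⟨s, hs, rfl⟩ := Finset.mem_image.1 hs'
        obtain ⟨t, ht, rfl⟩ := Finset.mem_image.1 ht'
        have := hT t ht s hs
        linarith) (fun t => g (-t))
      (by
        intro s
        rw [Finset.sum_image (fun x _ y _ h => neg_injective h)]
        rw [← hg (-s)]
        refine Finset.sum_congr rfl fun t _ => ?_
        simp only [neg_neg]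
        congr 2
        ring)
      (fun t h1 h2 => h0 _ (by linarith) (by linarith)) (-t) (by linarith)
    simpa using this

theorem aux_rec {d : ℕ} (f c : Euc d → ℂ) (v : Euc d) (hline : IsLinePolynomial f v)
    (hann : Annihilates f c) : ∃ (A : Finset ℝ) (a : ℝ → ℂ), (∀ t ∈ A, a t ≠ 0) ∧
      (∃ s ∈ A, ∃ t ∈ A, s ≠ t) ∧ ∀ u, ∑ t ∈ A, a t * c (u - t • v) = 0 := by
  classical
  obtain ⟨hf, hv, ⟨x, hx, y, hy, hxy⟩, u₀, hu⟩ := hline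
  have hu' : ∀ w, ∃ r : ℝ, w ∈ Function.support f → w = u₀ + r • v := by
    intro w
    by_cases h : w ∈ Function.support f
    · obtain ⟨r, hr⟩ := hu w h
      exact ⟨r, fun _ => hr⟩
    · exact ⟨0, fun h' => absurd h' h⟩
  choose ρ hρ using hu'
  have inj : ∀ z ∈ Function.support f, ∀ w ∈ Function.support f, ρ z = ρ w → z = w := by
    intro z hz w hw h
    rw [hρ z hz, hρ w hw, h]
  refine ⟨hf.toFinset.image ρ, fun t => f (u₀ + t • v), ?_, ?_, ?_⟩
  · intro t ht
    obtain ⟨w, hw, rfl⟩ := Finset.mem_image.1 ht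
    have hw' := hf.mem_toFinset.1 hw
    simp only
    rw [← hρ w hw']
    exact hw'
  · exact ⟨ρ x, Finset.mem_image_of_mem _ (hf.mem_toFinset.2 hx), ρ y,
      Finset.mem_image_of_mem _ (hf.mem_toFinset.2 hy), fun h => hxy (inj x hx y hy h)⟩
  · intro u
    rw [Finset.sum_image (fun z hz w hw h => inj z (hf.mem_toFinset.1 hz) w (hf.mem_toFinset.1 hw) h)]
    have h := hann (u + u₀)
    unfold conv at h
    rw [finsum_eq_sum_of_support_subset (s := hf.toFinset)] at h
    · rw [← h]
      refine Finset.sum_congr rfl fun w hw => ?_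
      have hw' := hρ w (hf.mem_toFinset.1 hw)
      have e : u - ρ w • v = u + u₀ - w := by
        nth_rewrite 2 [hw']
        abel
      simp only
      rw [e, ← hw']
    · intro w hw
      simp only [Set.Finite.coe_toFinset, Function.mem_support] at hw ⊢
      exact left_ne_zero_of_mul hw

theorem aux_finite {d : ℕ} (S : Set (Euc d)) (hS : SetLocallyFinite (S - S)) (v : Euc d)
    (hv : v ≠ 0) (z : Euc d) (B : ℝ) : {t : ℝ | |t| ≤ B ∧ z + t • v ∈ S - S}.Finite := by
  have h := hS (Metric.closedBall z (B * ‖v‖)) Metric.isBounded_closedBall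
  refine Set.Finite.of_finite_image (f := fun t : ℝ => z + t • v) (h.subset ?_) ?_
  · rintro _ ⟨t, ⟨ht, ht'⟩, rfl⟩
    refine ⟨ht', ?_⟩
    simp only [Metric.mem_closedBall, dist_eq_norm, add_sub_cancel_left, norm_smul, Real.norm_eq_abs]
    gcongr
  · intro s _ t _ h
    exact smul_left_injective ℝ hv (add_left_cancel h)

theorem aux_line {d : ℕ} (c : Euc d → ℂ) (hfin : (Set.range c).Finite)
    (hS : SetLocallyFinite (Function.support c - Function.support c)) (v : Euc d) (hv : v ≠ 0)
    (A : Finset ℝ) (a : ℝ → ℂ) (ha : ∀ t ∈ A, a t ≠ 0)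
    (hA : ∃ s ∈ A, ∃ t ∈ A, s ≠ t) (hrec : ∀ u, ∑ t ∈ A, a t * c (u - t • v) = 0) :
    ∃ B : ℝ, ∀ x, c x ≠ 0 → ∃ p : ℝ, 0 < p ∧ p ≤ B ∧
      Function.Periodic (fun t : ℝ => c (x + t • v)) p := by
  classical
  obtain ⟨s₀, hs₀, t₀, ht₀, hst⟩ := hA
  have hAne : A.Nonempty := ⟨s₀, hs₀⟩
  obtain ⟨M, hM, hmax⟩ := A.exists_max_image id hAne
  obtain ⟨m, hm, hmin⟩ := A.exists_min_image id hAne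
  simp only [id] at hmax hmin
  set T := M - m with hTdef
  have hT : ∀ s ∈ A, ∀ t ∈ A, s - t ≤ T := fun s hs t ht => by
    have := hmax s hs
    have := hmin t ht
    linarith
  have hT0 : 0 < T := by
    rcases lt_or_gt_of_ne hst with h | h
    · have := hT _ ht₀ _ hs₀
      linarith
    · have := hT _ hs₀ _ ht₀
      linarith
  have hD := aux_finite _ hS v hv 0 T
  set D := {t : ℝ | |t| ≤ T ∧ 0 + t • v ∈ Function.support c - Function.support c} with hDdef
  have := hD.to_subtype
  have := hfin.to_subtype
  have : Fintype (D → Set.range c) := Fintype.ofFinite _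
  set N := Fintype.card (D → Set.range c)
  have hstep : ∀ x, c x ≠ 0 → ∃ g : ℝ, 0 < g ∧ g ≤ T ∧ c (x + g • v) ≠ 0 := by
    intro x hx
    by_contra hcon
    push Not at hcon
    have h3 := hrec (x + M • v)
    rw [Finset.sum_eq_single_of_mem M hM] at h3
    · have h4 := (mul_eq_zero.1 h3).resolve_left (ha M hM)
      rw [add_sub_cancel_right] at h4
      exact hx h4
    · intro t ht htm
      have h5 := hcon (M - t) (sub_pos.2 (lt_of_le_of_ne (hmax t ht) htm)) (hT M hM t ht)
      have e : x + M • v - t • v = x + (M - t) • v := by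
        rw [sub_smul]; abel
      rw [e, h5, mul_zero]
  refine ⟨N * T, ?_⟩
  intro x hx
  choose! γ hγ using hstep
  -- the sequence of positions along the line
  let y : ℕ → ℝ := fun n => Nat.rec 0 (fun _ s => s + γ (x + s • v)) n
  have y0 : y 0 = 0 := rfl
  have ys : ∀ n, y (n+1) = y n + γ (x + y n • v) := fun n => rfl
  have yc : ∀ n, c (x + y n • v) ≠ 0 := by
    intro n
    induction n with
    | zero => simpa [y0] using hx
    | succ n ih =>
      have := (hγ _ ih).2.2
      rwa [add_assoc, ← add_smul, ← ys] at this
  have ymono : StrictMono y := strictMono_nat_of_lt_succ fun n => by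
    rw [ys]
    linarith [(hγ _ (yc n)).1]
  have yle : ∀ n : ℕ, y n ≤ n * T := by
    intro n
    induction n with
    | zero => simp [y0]
    | succ n ih =>
      rw [ys]
      push_cast
      linarith [(hγ _ (yc n)).2.1]
  obtain ⟨i, j, hij, hpat⟩ := Fintype.exists_ne_map_eq_of_card_lt
    (fun (n : Fin (N+1)) => (fun (t : D) => (⟨c (x + y n • v + (t : ℝ) • v), Set.mem_range_self _⟩ : Set.range c)))
    (by simp [N])
  wlog hlt : i < j generalizing i j
  · exact this j i hij.symm hpat.symm (lt_of_le_of_ne (not_lt.1 hlt) hij.symm)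
  have hpat' : ∀ t ∈ D, c (x + y i • v + t • v) = c (x + y j • v + t • v) := by
    intro t ht
    have := congrFun hpat ⟨t, ht⟩
    exact congrArg Subtype.val this
  have hlt' : y i < y j := ymono hlt
  have hall := aux_all A hAne a ha T hT0 hT
    (fun t => c (x + y i • v + t • v) - c (x + y j • v + t • v))
    (by
      intro s
      have h1 := hrec (x + y i • v + s • v)
      have h2 := hrec (x + y j • v + s • v)
      have : (0 : ℂ) = 0 - 0 := by simp
      rw [this]
      nth_rewrite 1 [← h1]
      rw [← h2, ← Finset.sum_sub_distrib]
      refine Finset.sum_congr rfl fun t _ => ?_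
      simp only [sub_smul, mul_sub, add_sub_assoc])
    (by
      intro t h1 h2
      by_cases ht : t ∈ D
      · simp only [hpat' t ht, sub_self]
      · have hz : ∀ n, c (x + y n • v + t • v) = 0 := by
          intro n
          by_contra hne
          refine ht ⟨abs_le.2 ⟨h1, h2⟩, ?_⟩
          exact Set.mem_sub.2 ⟨_, hne, _, yc n, by abel⟩
        simp only [hz, sub_self])
  refine ⟨y j - y i, sub_pos.2 hlt', ?_, ?_⟩
  · have h1 : 0 ≤ y i := by
      rw [← y0]; exact ymono.monotone (Nat.zero_le _)
    have h2 := yle j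
    have h3 : ((j : ℕ) : ℝ) ≤ N := by exact_mod_cast Nat.lt_succ_iff.1 j.2
    have : ((j : ℕ) : ℝ) * T ≤ N * T := by gcongr
    linarith
  · intro t
    have h := sub_eq_zero.1 (hall (t - y i))
    have e1 : x + y i • v + (t - y i) • v = x + t • v := by
      rw [sub_smul]; abel
    have e2 : x + y j • v + (t - y i) • v = x + (t + (y j - y i)) • v := by
      rw [sub_smul, add_smul, sub_smul]; abel
    rw [e1, e2] at h
    exact h.symm

theorem aux_comm {d : ℕ} (c : Euc d → ℂ)
    (hS : SetLocallyFinite (Function.support c - Function.support c)) (v : Euc d) (hv : v ≠ 0)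
    (x y : Euc d) (hx : c x ≠ 0) (hy : c y ≠ 0) (p q : ℝ) (hq : 0 < q)
    (hxp : Function.Periodic (fun t : ℝ => c (x + t • v)) p)
    (hyq : Function.Periodic (fun t : ℝ => c (y + t • v)) q) :
    ∃ m n : ℤ, m ≠ 0 ∧ m * p = n * q := by
  have hfinite := aux_finite _ hS v hv (x - y) q
  have hmaps : Set.MapsTo (fun k : ℤ => k * p - ⌊k * p / q⌋ * q) Set.univ
      {t : ℝ | |t| ≤ q ∧ x - y + t • v ∈ Function.support c - Function.support c} := by
    intro k _
    refine ⟨?_, ?_⟩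
    · have h1 := Int.floor_le (k * p / q)
      have h2 := Int.lt_floor_add_one (k * p / q)
      rw [le_div_iff₀ hq] at h1
      rw [div_lt_iff₀ hq] at h2
      rw [abs_le]
      constructor <;> simp only <;> linarith
    · refine Set.mem_sub.2 ⟨x + (k * p : ℝ) • v, ?_, y + (⌊k * p / q⌋ * q : ℝ) • v, ?_, ?_⟩
      · have := (hxp.int_mul k) 0
        simp only [zero_add, zero_smul, add_zero] at this
        rw [Function.mem_support, this]
        exact hx
      · have := (hyq.int_mul ⌊k * p / q⌋) 0
        simp only [zero_add, zero_smul, add_zero] at this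
        rw [Function.mem_support, this]
        exact hy
      · simp only [sub_smul]
        abel
  obtain ⟨k, _, l, _, hkl, h⟩ := Set.infinite_univ.exists_ne_map_eq_of_mapsTo hmaps hfinite
  refine ⟨k - l, ⌊k * p / q⌋ - ⌊l * p / q⌋, sub_ne_zero.2 hkl, ?_⟩
  push_cast
  linarith

theorem stmt_11 (d : ℕ) (hd : 0 < d) (c : Euc d → ℂ)
    (hfin : (Set.range c).Finite)
    (hsupp : DeloneFLC (Function.support c))
    (f : Euc d → ℂ) (v : Euc d) (hline : IsLinePolynomial f v)
    (hann : Annihilates f c) :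
    ∃ k : ℝ, k ≠ 0 ∧ ∀ u, c (u - k • v) = c u := by
  classical
  obtain ⟨A, a, ha, hA, hrec⟩ := aux_rec f c v hline hann
  have hv : v ≠ 0 := hline.2.1
  have hS := hsupp.2
  obtain ⟨B, hB⟩ := aux_line c hfin hS v hv A a ha hA hrec
  by_cases hc : ∃ x₀, c x₀ ≠ 0
  swap
  · push Not at hc
    exact ⟨1, one_ne_zero, fun u => by rw [hc, hc]⟩
  obtain ⟨x₀, hx₀⟩ := hc
  obtain ⟨p₀, hp₀, -, hper₀⟩ := hB x₀ hx₀
  have hP := aux_finite _ hS v hv 0 B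
  have hm : ∀ q : ℝ, ∃ m : ℤ, m ≠ 0 ∧ ∀ x, c x ≠ 0 → 0 < q →
      Function.Periodic (fun t : ℝ => c (x + t • v)) q → ∃ n : ℤ, m * p₀ = n * q := by
    intro q
    by_cases h : ∃ x, c x ≠ 0 ∧ 0 < q ∧ Function.Periodic (fun t : ℝ => c (x + t • v)) q
    · obtain ⟨x, hx, hq, hper⟩ := h
      obtain ⟨m, n, hm, hmn⟩ := aux_comm c hS v hv x₀ x hx₀ hx p₀ q hq hper₀ hper
      exact ⟨m, hm, fun _ _ _ _ => ⟨n, hmn⟩⟩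
    · exact ⟨1, one_ne_zero, fun x hx hq hper => absurd ⟨x, hx, hq, hper⟩ h⟩
  choose m hm0 hm using hm
  set K : ℤ := ∏ q ∈ hP.toFinset, m q with hK
  have hK0 : K ≠ 0 := Finset.prod_ne_zero_iff.2 fun q _ => hm0 q
  have key : ∀ x, c x ≠ 0 → Function.Periodic (fun t : ℝ => c (x + t • v)) (K * p₀) := by
    intro x hx
    obtain ⟨q, hq, hqB, hper⟩ := hB x hx
    obtain ⟨n, hn⟩ := hm q x hx hq hper
    have hqP : q ∈ hP.toFinset := by
      rw [Set.Finite.mem_toFinset]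
      refine ⟨by rwa [abs_of_pos hq], Set.mem_sub.2 ⟨x + q • v, ?_, x, hx, by abel⟩⟩
      have := hper 0
      simp only [zero_add, zero_smul, add_zero] at this
      rw [Function.mem_support, this]
      exact hx
    obtain ⟨l, hl⟩ := Finset.dvd_prod_of_mem m hqP
    have e : (K : ℝ) * p₀ = ((l * n : ℤ) : ℝ) * q := by
      rw [hK, hl]
      push_cast
      linear_combination (l : ℝ) * hn
    rw [e]
    exact hper.int_mul _
  refine ⟨K * p₀, mul_ne_zero (by exact_mod_cast hK0) hp₀.ne', ?_⟩
  intro u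
  by_cases h1 : c u = 0
  · by_cases h2 : c (u - ((K : ℝ) * p₀) • v) = 0
    · rw [h1, h2]
    · have := key _ h2 0
      simp only [zero_add, zero_smul, add_zero, sub_add_cancel] at this
      exact this.symm
  · have := key _ h1 (-(K * p₀))
    simp only [neg_add_cancel, zero_smul, add_zero, neg_smul, ← sub_eq_add_neg] at this
    exact this.symm

end
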